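/- (Lemma A.6, variance algebra under the null) Let (Ȳ(1), Ȳ(0), X, N) satisfy the common moment conditions with E[N]>0, and suppose E[NȲ(1)] = E[NȲ(0)]. Then (1/E[N]²)·( E[Var[NȲ(1)|X]] + E[Var[NȲ(0)|X]] + E[(E[NȲ(1)|X] − E[NȲ(0)|X])²] − 2(E[NȲ(1)]/E[N])(E[N²Ȳ(1)] − E[E[NȲ(1)|X]E[N|X]]) − 2(E[NȲ(0)]/E[N])(E[N²Ȳ(0)] − E[E[NȲ(0)|X]E[N|X]]) + 2(E[NȲ(0)]/E[N])²E[Var[N|X]] ) = E[Var[Ỹ(1)|X]] + E[Var[Ỹ(0)|X]] + E[(E[Ỹ(1)|X] − E[Ỹ(0)|X])²], where Ỹ(d) = (N/E[N])(Ȳ(d) − E[Ȳ(d)N]/E[N]). -/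

import Mathlib

open MeasureTheory ProbabilityTheory Filter
open scoped ENNReal NNReal Topology

/-- Conditional expectation of an affine combination `a * (W - b * V)`. -/
lemma condExp_mul_sub {Ω : Type*} {m m₀ : MeasurableSpace Ω} {μ : Measure[m₀] Ω}
    {W V : Ω → ℝ} (hW : Integrable W μ) (hV : Integrable V μ) (a b : ℝ) :
    μ[fun ω => a * (W ω - b * V ω) | m]
      =ᵐ[μ] fun ω => a * ((μ[W | m]) ω - b * (μ[V | m]) ω) := by
  filter_upwards [condExp_smul a (W - b • V) m, condExp_sub hW (hV.smul b) m,
    condExp_smul b V m] with ω h₁ h₂ h₃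
  have h : (fun ω => a * (W ω - b * V ω)) = a • (W - b • V) := by
    ext ω
    simp
  rw [h, h₁, Pi.smul_apply, h₂, Pi.sub_apply, h₃, Pi.smul_apply, smul_eq_mul, smul_eq_mul]

/-- If `E[f | m] ≤ C` almost surely for a nonnegative integrable `f`, then `f * g` is integrable for
every `m`-measurable nonnegative integrable `g`. -/
lemma integrable_mul_of_condExp_le {Ω : Type*} {m m₀ : MeasurableSpace Ω} {μ : Measure[m₀] Ω}
    [IsFiniteMeasure μ] (hm : m ≤ m₀) {f g : Ω → ℝ} {C : ℝ} (hf : Integrable f μ)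
    (hf0 : ∀ ω, 0 ≤ f ω) (hC : ∀ᵐ ω ∂μ, (μ[f | m]) ω ≤ C) (hg : Integrable g μ)
    (hgm : Measurable[m] g) (hg0 : ∀ ω, 0 ≤ g ω) :
    Integrable (fun ω => g ω * f ω) μ := by
  have hset (n : ℕ) : MeasurableSet[m] {ω | g ω ≤ n} := hgm measurableSet_Iic
  have hcover : AECover μ atTop (fun n : ℕ => {ω | g ω ≤ n}) :=
    { ae_eventually_mem := by
        refine ae_of_all _ fun ω => ?_
        obtain ⟨n, hn⟩ := exists_nat_ge (g ω)
        filter_upwards [eventually_ge_atTop n] with k hk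
        exact hn.trans (by exact_mod_cast hk)
      measurableSet := fun n => hm _ (hset n) }
  have htrunc (n : ℕ) : StronglyMeasurable[m] ({ω | g ω ≤ n}.indicator g) :=
    (hgm.indicator (hset n)).stronglyMeasurable
  have hbdd (n : ℕ) (ω : Ω) : ‖{ω | g ω ≤ n}.indicator g ω‖ ≤ n := by
    by_cases h : g ω ≤ n
    · rwa [Set.indicator_of_mem (by exact h), Real.norm_of_nonneg (hg0 ω)]
    · rw [Set.indicator_of_notMem (by exact h)]
      simp
  have hint (n : ℕ) {u : Ω → ℝ} (hu : Integrable u μ) :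
      Integrable ({ω | g ω ≤ n}.indicator g * u) μ :=
    hu.bdd_mul ((htrunc n).mono hm).aestronglyMeasurable (ae_of_all _ (hbdd n))
  have hmul (n : ℕ) : {ω | g ω ≤ n}.indicator (fun ω => g ω * f ω)
      = {ω | g ω ≤ n}.indicator g * f := by
    ext ω
    simp only [Pi.mul_apply, Set.indicator_apply]
    split_ifs <;> simp
  refine hcover.integrable_of_integral_norm_bounded (∫ ω, g ω * C ∂μ) (fun n => ?_)
    (Eventually.of_forall fun n => ?_)
  · rw [← integrable_indicator_iff (hm _ (hset n)), hmul]
    exact hint n hf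
  · have hC0 : ∀ᵐ ω ∂μ, 0 ≤ (μ[f | m]) ω := condExp_nonneg (ae_of_all _ hf0)
    calc ∫ ω in {ω | g ω ≤ n}, ‖g ω * f ω‖ ∂μ
        = ∫ ω in {ω | g ω ≤ n}, g ω * f ω ∂μ := by
          simp only [Real.norm_of_nonneg (mul_nonneg (hg0 _) (hf0 _))]
      _ = ∫ ω, ({ω | g ω ≤ n}.indicator g * f) ω ∂μ := by
          rw [← integral_indicator (hm _ (hset n)), hmul]
      _ = ∫ ω, (μ[{ω | g ω ≤ n}.indicator g * f | m]) ω ∂μ := (integral_condExp hm).symm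
      _ = ∫ ω, ({ω | g ω ≤ n}.indicator g * μ[f | m]) ω ∂μ :=
          integral_congr_ae (condExp_mul_of_stronglyMeasurable_left (htrunc n) (hint n hf) hf)
      _ ≤ ∫ ω, g ω * C ∂μ := by
          refine integral_mono_ae (hint n integrable_condExp) (hg.mul_const C) ?_
          filter_upwards [hC, hC0] with ω h h0
          exact mul_le_mul (Set.indicator_le_self' (fun _ _ => hg0 _) ω) h h0 (hg0 ω)

/-- Expected conditional variance of an affine combination `a * (W - b * V)`. -/
lemma integral_condExp_sq_sub_sq_condExp_mul_sub {Ω : Type*} {m m₀ : MeasurableSpace Ω}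
    {μ : Measure[m₀] Ω} [IsFiniteMeasure μ] (hm : m ≤ m₀) {W V : Ω → ℝ}
    (hW : MemLp W 2 μ) (hV : MemLp V 2 μ) (a b : ℝ) :
    ∫ ω, ((μ[fun ω => (a * (W ω - b * V ω)) ^ 2 | m]) ω
        - (μ[fun ω => a * (W ω - b * V ω) | m]) ω ^ 2) ∂μ
      = a ^ 2 * (∫ ω, ((μ[fun ω => W ω ^ 2 | m]) ω - (μ[W | m]) ω ^ 2) ∂μ
        - 2 * b * (∫ ω, W ω * V ω ∂μ - ∫ ω, (μ[W | m]) ω * (μ[V | m]) ω ∂μ)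
        + b ^ 2 * ∫ ω, ((μ[fun ω => V ω ^ 2 | m]) ω - (μ[V | m]) ω ^ 2) ∂μ) := by
  have hexpand {P Q : Ω → ℝ} (hP : MemLp P 2 μ) (hQ : MemLp Q 2 μ) :
      ∫ ω, (a * (P ω - b * Q ω)) ^ 2 ∂μ
        = a ^ 2 * (∫ ω, P ω ^ 2 ∂μ - 2 * b * ∫ ω, P ω * Q ω ∂μ + b ^ 2 * ∫ ω, Q ω ^ 2 ∂μ) := by
    have hPQ : Integrable (fun ω => P ω * Q ω) μ := hP.integrable_mul hQ
    have hsq (ω : Ω) : (a * (P ω - b * Q ω)) ^ 2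
        = a ^ 2 * (P ω ^ 2 - 2 * b * (P ω * Q ω) + b ^ 2 * Q ω ^ 2) := by ring
    simp_rw [hsq]
    rw [integral_const_mul, integral_add (by exact hP.integrable_sq.sub (hPQ.const_mul _))
      (hQ.integrable_sq.const_mul _), integral_sub hP.integrable_sq (hPQ.const_mul _),
      integral_const_mul, integral_const_mul]
  have hsub {P : Ω → ℝ} (hP : MemLp P 2 μ) :
      ∫ ω, ((μ[fun ω => P ω ^ 2 | m]) ω - (μ[P | m]) ω ^ 2) ∂μ
        = ∫ ω, P ω ^ 2 ∂μ - ∫ ω, (μ[P | m]) ω ^ 2 ∂μ := by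
    rw [integral_sub integrable_condExp (hP.condExp one_le_two).integrable_sq, integral_condExp hm]
  have hT : MemLp (fun ω => a * (W ω - b * V ω)) 2 μ := (hW.sub (hV.const_mul b)).const_mul a
  have hcond := condExp_mul_sub (m := m) (hW.integrable one_le_two) (hV.integrable one_le_two) a b
  rw [hsub hT, hsub hW, hsub hV, hexpand hW hV,
    integral_congr_ae (hcond.mono fun ω h => congrArg (· ^ 2) h),
    hexpand (hW.condExp one_le_two) (hV.condExp one_le_two)]
  ring

/-- **Lemma A.6 (variance algebra under the null).**  If `E[NȲ(1)] = E[NȲ(0)]`, then the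
randomization-distribution variance expression equals
`E[Var[Ỹ(1)|X]] + E[Var[Ỹ(0)|X]] + E[(E[Ỹ(1)|X] − E[Ỹ(0)|X])²]`, where
`Var[Z|X] = E[Z²|X] − (E[Z|X])²`. -/
theorem variance_algebra_under_the_null
    {Ω : Type*} [MeasureSpace Ω] [IsProbabilityMeasure (ℙ : Measure Ω)]
    {k : ℕ} (Ybar : Fin 2 → Ω → ℝ) (X : Ω → EuclideanSpace ℝ (Fin k)) (N : Ω → ℕ)
    (hYmeas : ∀ d, Measurable (Ybar d)) (hXmeas : Measurable X) (hNmeas : Measurable N)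
    (hNpos : ∀ ω, 1 ≤ N ω)
    -- common moment conditions, with E[N] > 0
    (hN2 : Integrable (fun ω => (N ω : ℝ) ^ 2) ℙ)
    (hENpos : 0 < 𝔼[fun ω => (N ω : ℝ)])
    (C : ℝ) (hYsqInt : ∀ d, Integrable (fun ω => Ybar d ω ^ 2) ℙ)
    (hYbound : ∀ d : Fin 2, ∀ᵐ ω ∂ℙ,
      (ℙ[fun ω' => Ybar d ω' ^ 2 |
        MeasurableSpace.comap (fun ω' => (X ω', N ω')) inferInstance]) ω ≤ C)
    -- the null restriction E[NȲ(1)] = E[NȲ(0)]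
    (hnull : 𝔼[fun ω => Ybar 1 ω * (N ω : ℝ)] = 𝔼[fun ω => Ybar 0 ω * (N ω : ℝ)])
    -- names for the moments and conditional expectations in the identity
    (EN : ℝ) (hEN : EN = 𝔼[fun ω => (N ω : ℝ)])
    (EYN EYN2 : Fin 2 → ℝ)
    (hEYN : ∀ d, EYN d = 𝔼[fun ω => Ybar d ω * (N ω : ℝ)])
    (hEYN2 : ∀ d, EYN2 d = 𝔼[fun ω => Ybar d ω * (N ω : ℝ) ^ 2])
    (cY cY2 : Fin 2 → Ω → ℝ)
    (hcY : ∀ d, cY d = ℙ[fun ω => Ybar d ω * (N ω : ℝ) | MeasurableSpace.comap X inferInstance])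
    (hcY2 : ∀ d, cY2 d =
      ℙ[fun ω => (Ybar d ω * (N ω : ℝ)) ^ 2 | MeasurableSpace.comap X inferInstance])
    (cN cN2 : Ω → ℝ)
    (hcN : cN = ℙ[fun ω => (N ω : ℝ) | MeasurableSpace.comap X inferInstance])
    (hcN2 : cN2 = ℙ[fun ω => (N ω : ℝ) ^ 2 | MeasurableSpace.comap X inferInstance])
    -- the transformed outcomes Ỹ(d) and their conditional moments
    (Ytilde : Fin 2 → Ω → ℝ)
    (hYtilde : ∀ d ω, Ytilde d ω = ((N ω : ℝ) / EN) * (Ybar d ω - EYN d / EN))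
    (cT cT2 : Fin 2 → Ω → ℝ)
    (hcT : ∀ d, cT d = ℙ[Ytilde d | MeasurableSpace.comap X inferInstance])
    (hcT2 : ∀ d, cT2 d = ℙ[fun ω => Ytilde d ω ^ 2 | MeasurableSpace.comap X inferInstance]) :
    (1 / EN ^ 2) *
      (𝔼[fun ω => cY2 1 ω - cY 1 ω ^ 2] + 𝔼[fun ω => cY2 0 ω - cY 0 ω ^ 2] +
        𝔼[fun ω => (cY 1 ω - cY 0 ω) ^ 2] -
        2 * (EYN 1 / EN) * (EYN2 1 - 𝔼[fun ω => cY 1 ω * cN ω]) -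
        2 * (EYN 0 / EN) * (EYN2 0 - 𝔼[fun ω => cY 0 ω * cN ω]) +
        2 * (EYN 0 / EN) ^ 2 * 𝔼[fun ω => cN2 ω - cN ω ^ 2])
    = 𝔼[fun ω => cT2 1 ω - cT 1 ω ^ 2] + 𝔼[fun ω => cT2 0 ω - cT 0 ω ^ 2] +
        𝔼[fun ω => (cT 1 ω - cT 0 ω) ^ 2] := by
  have hmX : MeasurableSpace.comap X inferInstance ≤ (inferInstance : MeasurableSpace Ω) :=
    hXmeas.comap_le
  have hmXN : MeasurableSpace.comap (fun ω' => (X ω', N ω')) inferInstance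
      ≤ (inferInstance : MeasurableSpace Ω) := (hXmeas.prodMk hNmeas).comap_le
  have hNreal : Measurable fun ω => (N ω : ℝ) := measurable_from_nat.comp hNmeas
  have hV : MemLp (fun ω => (N ω : ℝ)) 2 ℙ :=
    (memLp_two_iff_integrable_sq hNreal.aestronglyMeasurable).2 hN2
  have hNcomap : Measurable[MeasurableSpace.comap (fun ω' => (X ω', N ω')) inferInstance]
      fun ω => (N ω : ℝ) ^ 2 :=
    (measurable_from_nat (f := fun n : ℕ => (n : ℝ) ^ 2)).comp
      (measurable_snd.comp (comap_measurable fun ω' => (X ω', N ω')))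
  have hW (d : Fin 2) : MemLp (fun ω => Ybar d ω * (N ω : ℝ)) 2 ℙ := by
    refine (memLp_two_iff_integrable_sq ((hYmeas d).mul hNreal).aestronglyMeasurable).2 ?_
    refine (integrable_mul_of_condExp_le hmXN (hYsqInt d) (fun _ => sq_nonneg _) (hYbound d) hN2
      hNcomap (fun _ => sq_nonneg _)).congr (ae_of_all _ fun ω => ?_)
    simp only [Pi.mul_apply]
    ring
  have hT (d : Fin 2) : Ytilde d
      = fun ω => EN⁻¹ * (Ybar d ω * (N ω : ℝ) - EYN d / EN * (N ω : ℝ)) := by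
    ext ω
    rw [hYtilde]
    ring
  have hEYN_eq : EYN 1 = EYN 0 := by rw [hEYN, hEYN, hnull]
  have hvar (d : Fin 2) : 𝔼[fun ω => cT2 d ω - cT d ω ^ 2]
      = EN⁻¹ ^ 2 * (𝔼[fun ω => cY2 d ω - cY d ω ^ 2]
        - 2 * (EYN d / EN) * (EYN2 d - 𝔼[fun ω => cY d ω * cN ω])
        + (EYN d / EN) ^ 2 * 𝔼[fun ω => cN2 ω - cN ω ^ 2]) := by
    have hmoment : EYN2 d = ∫ ω, Ybar d ω * (N ω : ℝ) * (N ω : ℝ) := by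
      rw [hEYN2]
      congr 1 with ω
      ring
    rw [hcT2, hcT, hT, hcY, hcY2, hcN, hcN2, hmoment]
    exact integral_condExp_sq_sub_sq_condExp_mul_sub hmX (hW d) hV EN⁻¹ (EYN d / EN)
  have hcond (d : Fin 2) : cT d =ᵐ[ℙ] fun ω => EN⁻¹ * (cY d ω - EYN d / EN * cN ω) := by
    rw [hcT, hT, hcY, hcN]
    exact condExp_mul_sub ((hW d).integrable one_le_two) (hV.integrable one_le_two) _ _
  have hdiff : 𝔼[fun ω => (cT 1 ω - cT 0 ω) ^ 2]
      = EN⁻¹ ^ 2 * 𝔼[fun ω => (cY 1 ω - cY 0 ω) ^ 2] := by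
    rw [← integral_const_mul]
    refine integral_congr_ae ?_
    filter_upwards [hcond 1, hcond 0] with ω h₁ h₀
    rw [h₁, h₀, hEYN_eq]
    ring
  rw [hvar, hvar, hdiff, hEYN_eq]
  ring
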